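/- Let f : 2^[m] → ℝ≥0 be a (not necessarily subadditive) MPH-k valuation that is normalized, monotone, and has all marginal values in [0,1] (i.e., 0 ≤ f(S∪{i}) − f(S) ≤ 1 for all S,i). Then f is (k,0)-self-bounding; in particular, for every S ⊆ [m], ∑_{j∈[m]} ( f(S) − f(S∖{j}) ) ≤ k·f(S). -/

import Mathlib

open Finset

/-- A normalized monotone valuation `f : 2^[m] → ℝ≥0`. -/
def IsValuation (m : ℕ) (f : Finset (Fin m) → ℝ) : Prop :=
  f ∅ = 0 ∧ (∀ S T : Finset (Fin m), S ⊆ T → f S ≤ f T) ∧ ∀ S, 0 ≤ f S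

/-- `a` is a PH-`k` valuation: a nonnegative weighted sum of hyperedges of size at most `k`. -/
def IsPHk (m k : ℕ) (a : Finset (Fin m) → ℝ) : Prop :=
  ∃ w : Finset (Fin m) → ℝ, (∀ E, 0 ≤ w E) ∧ (∀ E, k < E.card → w E = 0) ∧
    ∀ S : Finset (Fin m), a S = ∑ T ∈ S.powerset, w T

/-- `f` is MPH-`k`: a pointwise maximum of a collection of PH-`k` valuations. -/
def IsMPHk (m k : ℕ) (f : Finset (Fin m) → ℝ) : Prop :=
  ∃ A : Set (Finset (Fin m) → ℝ), (∀ a ∈ A, IsPHk m k a) ∧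
    ∀ S, IsGreatest ((fun a => a S) '' A) (f S)

/-- `f` is `(a,b)`-self-bounding: there are functions `g i`, not depending on the `i`-th
coordinate, with `0 ≤ f S - g i S ≤ 1` and `∑ i, (f S - g i S) ≤ a * f S + b`. -/
def IsSelfBounding (m : ℕ) (a b : ℝ) (f : Finset (Fin m) → ℝ) : Prop :=
  ∃ g : Fin m → Finset (Fin m) → ℝ,
    (∀ (i : Fin m) (S : Finset (Fin m)), g i S = g i (S.erase i)) ∧
    (∀ (i : Fin m) (S : Finset (Fin m)), 0 ≤ f S - g i S ∧ f S - g i S ≤ 1) ∧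
    ∀ S : Finset (Fin m), ∑ i : Fin m, (f S - g i S) ≤ a * f S + b

/-- The marginal of a hypergraph valuation at `j` is the total weight of the hyperedges
containing `j`. -/
theorem sum_powerset_sub_sum_powerset_erase {α : Type*} [DecidableEq α] (w : Finset α → ℝ)
    (S : Finset α) (j : α) :
    ∑ T ∈ S.powerset, w T - ∑ T ∈ (S.erase j).powerset, w T =
      ∑ T ∈ S.powerset, if j ∈ T then w T else 0 := by
  have h : (S.erase j).powerset = S.powerset.filter (fun T => j ∉ T) := by
    ext T
    simp [Finset.subset_erase]
  rw [h, Finset.sum_filter, ← Finset.sum_sub_distrib]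
  refine Finset.sum_congr rfl fun T _ => ?_
  by_cases hj : j ∈ T <;> simp [hj]

/-- The marginals of a PH-`k` valuation `a` at `S` sum to at most `k * a S`. -/
theorem IsPHk.sum_sub_erase_le {m k : ℕ} {a : Finset (Fin m) → ℝ} (ha : IsPHk m k a)
    (S : Finset (Fin m)) : ∑ j : Fin m, (a S - a (S.erase j)) ≤ (k : ℝ) * a S := by
  obtain ⟨w, hw, hwk, haw⟩ := ha
  simp only [haw, sum_powerset_sub_sum_powerset_erase]
  rw [Finset.sum_comm, Finset.mul_sum]
  refine Finset.sum_le_sum fun T _ => ?_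
  rw [← Finset.sum_filter, Finset.sum_const, nsmul_eq_mul, Finset.filter_univ_mem]
  rcases le_or_gt T.card k with h | h
  · exact mul_le_mul_of_nonneg_right (by exact_mod_cast h) (hw T)
  · simp [hwk T h]

/-- The marginals of an MPH-`k` valuation `f` at `S` sum to at most `k * f S`. -/
theorem IsMPHk.sum_sub_erase_le {m k : ℕ} {f : Finset (Fin m) → ℝ} (hf : IsMPHk m k f)
    (S : Finset (Fin m)) : ∑ j : Fin m, (f S - f (S.erase j)) ≤ (k : ℝ) * f S := by
  obtain ⟨A, hA, hmax⟩ := hf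
  obtain ⟨a, haA, haS⟩ := (hmax S).1
  replace haS : a S = f S := haS
  rw [← haS]
  refine le_trans (Finset.sum_le_sum fun j _ => ?_) ((hA a haA).sum_sub_erase_le S)
  exact sub_le_sub_left ((hmax (S.erase j)).2 ⟨a, haA, rfl⟩) _

theorem MPHk_selfBounding (m k : ℕ) (f : Finset (Fin m) → ℝ)
    (hval : IsValuation m f)
    (hmarg : ∀ (S : Finset (Fin m)) (i : Fin m),
      0 ≤ f (insert i S) - f S ∧ f (insert i S) - f S ≤ 1)
    (hmph : IsMPHk m k f) :
    IsSelfBounding m (k : ℝ) 0 f ∧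
      ∀ S : Finset (Fin m), ∑ j : Fin m, (f S - f (S.erase j)) ≤ (k : ℝ) * f S := by
  refine ⟨⟨fun i S => f (S.erase i), fun i S => by simp, fun i S => ?_, fun S => ?_⟩,
    hmph.sum_sub_erase_le⟩
  · by_cases hi : i ∈ S
    · simpa only [Finset.insert_erase hi] using hmarg (S.erase i) i
    · simp [Finset.erase_eq_of_notMem hi]
  · simpa using hmph.sum_sub_erase_le S
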